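/- Assume LICQ holds on S and that f is bounded from below on S. Then the set f(Σ(f,S)) ∪ T_∞(f,S) is a nonempty finite subset of ℝ and inf{f(x) : x ∈ S} = min{λ : λ ∈ f(Σ(f,S)) ∪ T_∞(f,S)}. -/

import Mathlib

open Filter

noncomputable section

def IsPolyFun {n : ℕ} (f : EuclideanSpace ℝ (Fin n) → ℝ) : Prop :=
  ∃ P : MvPolynomial (Fin n) ℝ, ∀ x, f x = MvPolynomial.eval (fun i => x i) P

def conSet {n l m : ℕ} (g : Fin l → EuclideanSpace ℝ (Fin n) → ℝ)
    (h : Fin m → EuclideanSpace ℝ (Fin n) → ℝ) : Set (EuclideanSpace ℝ (Fin n)) :=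
  {x | (∀ i, g i x = 0) ∧ (∀ j, 0 ≤ h j x)}

def LICQ {n l m : ℕ} (g : Fin l → EuclideanSpace ℝ (Fin n) → ℝ)
    (h : Fin m → EuclideanSpace ℝ (Fin n) → ℝ) : Prop :=
  ∀ x ∈ conSet g h, LinearIndependent ℝ
    (Sum.elim (fun i : Fin l => gradient (g i) x)
      (fun j : {j : Fin m // h j x = 0} => gradient (h j.1) x))

def criticalSet {n l m : ℕ} (f : EuclideanSpace ℝ (Fin n) → ℝ)
    (g : Fin l → EuclideanSpace ℝ (Fin n) → ℝ)
    (h : Fin m → EuclideanSpace ℝ (Fin n) → ℝ) : Set (EuclideanSpace ℝ (Fin n)) :=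
  {x | x ∈ conSet g h ∧ ∃ (lam : Fin l → ℝ) (nu : Fin m → ℝ),
    gradient f x - ∑ i, lam i • gradient (g i) x - ∑ j, nu j • gradient (h j) x = 0 ∧
    ∀ j, nu j * h j x = 0}

def tangencySet {n l m : ℕ} (f : EuclideanSpace ℝ (Fin n) → ℝ)
    (g : Fin l → EuclideanSpace ℝ (Fin n) → ℝ)
    (h : Fin m → EuclideanSpace ℝ (Fin n) → ℝ) : Set (EuclideanSpace ℝ (Fin n)) :=
  {x | x ∈ conSet g h ∧ ∃ (κ : ℝ) (lam : Fin l → ℝ) (nu : Fin m → ℝ) (μ : ℝ),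
    (κ, lam, nu, μ) ≠ 0 ∧
    κ • gradient f x - ∑ i, lam i • gradient (g i) x - ∑ j, nu j • gradient (h j) x - μ • x = 0 ∧
    ∀ j, nu j * h j x = 0}

def tangencyValues {n l m : ℕ} (f : EuclideanSpace ℝ (Fin n) → ℝ)
    (g : Fin l → EuclideanSpace ℝ (Fin n) → ℝ)
    (h : Fin m → EuclideanSpace ℝ (Fin n) → ℝ) : Set ℝ :=
  {lam | ∃ x : ℕ → EuclideanSpace ℝ (Fin n), (∀ k, x k ∈ tangencySet f g h) ∧
    Tendsto (fun k => ‖x k‖) atTop atTop ∧ Tendsto (fun k => f (x k)) atTop (nhds lam)}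

def psi {n l m : ℕ} (f : EuclideanSpace ℝ (Fin n) → ℝ)
    (g : Fin l → EuclideanSpace ℝ (Fin n) → ℝ)
    (h : Fin m → EuclideanSpace ℝ (Fin n) → ℝ) (t : ℝ) : EReal :=
  sInf ((fun x => (f x : EReal)) '' {x | x ∈ conSet g h ∧ ‖x‖ = t})

def CoerciveOn {n : ℕ} (f : EuclideanSpace ℝ (Fin n) → ℝ)
    (S : Set (EuclideanSpace ℝ (Fin n))) : Prop :=
  ∀ x : ℕ → EuclideanSpace ℝ (Fin n), (∀ k, x k ∈ S) →
    Tendsto (fun k => ‖x k‖) atTop atTop → Tendsto (fun k => f (x k)) atTop atTop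

theorem Derivation.exists_extension_of_formallyEtale (k P : Type*) {K : Type*} [CommRing k]
    [CommRing P] [CommRing K] [Algebra k P] [Algebra k K] [Algebra P K] [IsScalarTower k P K]
    [Algebra.FormallyEtale P K] (d : Derivation k P K) :
    ∃ D : Derivation k K K, ∀ p : P, D (algebraMap P K p) = d p := by
  let φ : Ω[K⁄k] →ₗ[K] K := (TensorProduct.AlgebraTensorModule.lift
    ((LinearMap.ringLmapEquivSelf K K (Ω[P⁄k] →ₗ[P] K)).symm d.liftKaehlerDifferential)).comp
      (KaehlerDifferential.tensorKaehlerEquivOfFormallyEtale k P K).symm.toLinearMap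
  refine ⟨φ.compDer (KaehlerDifferential.D k K), fun p => ?_⟩
  simp [φ, KaehlerDifferential.tensorKaehlerEquivOfFormallyEtale_symm_D_algebraMap]

theorem AlgebraicIndependent.exists_derivation {k K ι : Type*} [Field k] [CharZero k] [Field K]
    [Algebra k K] {y : ι → K} (hy : AlgebraicIndependent k y) (c : ι → K) :
    ∃ D : Derivation k K K, ∀ i, D (y i) = c i := by
  classical
  obtain ⟨s, hsub, hs⟩ := exists_isTranscendenceBasis_superset hy.to_subtype_range
  let : Algebra (MvPolynomial s k) K := (MvPolynomial.aeval ((↑) : s → K)).toAlgebra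
  have : IsScalarTower k (MvPolynomial s k) K :=
    .of_algebraMap_eq fun r => (AlgHom.commutes (MvPolynomial.aeval ((↑) : s → K)) r).symm
  have hinj : Function.Injective (algebraMap (MvPolynomial s k) K) := hs.1
  have : FaithfulSMul (MvPolynomial s k) K := (faithfulSMul_iff_algebraMap_injective _ _).2 hinj
  have : Algebra.IsAlgebraic (MvPolynomial s k) K := by
    have := hs.isAlgebraic
    refine Algebra.IsAlgebraic.of_ringHom_of_comp_eq hs.1.aevalEquiv (RingHom.id K)
      hs.1.aevalEquiv.surjective Function.injective_id (RingHom.ext fun p => ?_)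
    exact hs.1.algebraMap_aevalEquiv p
  let := FractionRing.liftAlgebra (MvPolynomial s k) K
  have := FractionRing.isScalarTower_liftAlgebra (MvPolynomial s k) K
  have : Algebra.IsAlgebraic (FractionRing (MvPolynomial s k)) K :=
    (IsFractionRing.comap_isAlgebraic_iff (A := MvPolynomial s k)).1 inferInstance
  have : CharZero (FractionRing (MvPolynomial s k)) := algebraRat.charZero _
  have := Algebra.FormallyEtale.of_isSeparable (FractionRing (MvPolynomial s k)) K
  have := Algebra.FormallyEtale.of_isLocalization (Rₘ := FractionRing (MvPolynomial s k))
    (nonZeroDivisors (MvPolynomial s k))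
  have := Algebra.FormallyEtale.comp (MvPolynomial s k) (FractionRing (MvPolynomial s k)) K
  obtain ⟨D, hD⟩ := Derivation.exists_extension_of_formallyEtale k (MvPolynomial s k) (K := K)
    (MvPolynomial.mkDerivation k (fun a : s => Function.extend y c 0 a))
  refine ⟨D, fun i => ?_⟩
  have h := hD (MvPolynomial.X ⟨y i, hsub ⟨i, rfl⟩⟩)
  simpa [RingHom.algebraMap_toAlgebra, hy.injective.extend_apply] using h

open MvPolynomial in
theorem Derivation.map_mvPolynomial_aeval {k K σ : Type*} [CommRing k] [CommRing K] [Algebra k K]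
    [Fintype σ] (D : Derivation k K K) (x : σ → K) (p : MvPolynomial σ k) :
    D (aeval x p) = ∑ i, aeval x (pderiv i p) * D (x i) := by
  classical
  induction p using MvPolynomial.induction_on with
  | C a => simp
  | add p q hp hq => simp [hp, hq, add_mul, Finset.sum_add_distrib]
  | mul_X p j hp =>
    simp [hp, pderiv_X, Pi.single_apply, apply_ite (aeval x), add_mul,
      Finset.sum_add_distrib, Finset.mul_sum, mul_assoc]

open MvPolynomial in
theorem Derivation.sum_mul_map_mvPolynomial_aeval {k K σ δ : Type*} [CommRing k] [CommRing K]
    [Algebra k K] [Fintype σ] [Fintype δ] (D : Derivation k K K) (x : σ → K) (w : δ → K)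
    (p : δ → MvPolynomial σ k) :
    ∑ c, w c * D (aeval x (p c)) = ∑ i, (∑ c, w c * aeval x (pderiv i (p c))) * D (x i) := by
  simp_rw [D.map_mvPolynomial_aeval x, Finset.mul_sum, Finset.sum_mul]
  rw [Finset.sum_comm]
  simp_rw [mul_assoc]

open MvPolynomial in
theorem not_algebraicIndependent_of_multipliers {k K σ α β γ : Type*} [Field k] [CharZero k]
    [Field K] [Algebra k K] [Fintype σ] [Fintype α] [Fintype β] [Fintype γ]
    (y : γ → MvPolynomial σ k) (G : α → MvPolynomial σ k) (H : β → MvPolynomial σ k)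
    (x : σ → K) (lam : α → K) (nu : β → K) (mu : γ → K) (hmu : mu ≠ 0)
    (hG : ∀ a, aeval x (G a) = 0) (hH : ∀ b, nu b * aeval x (H b) = 0)
    (hd : ∀ i, ∑ c, mu c * aeval x (pderiv i (y c)) =
      ∑ a, lam a * aeval x (pderiv i (G a)) + ∑ b, nu b * aeval x (pderiv i (H b))) :
    ¬ AlgebraicIndependent k (fun c => aeval x (y c)) := by
  classical
  intro hy
  obtain ⟨o, ho⟩ := Function.ne_iff.1 hmu
  obtain ⟨D, hD⟩ := hy.exists_derivation (Pi.single o 1)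
  have hnu : ∀ b, nu b * D (aeval x (H b)) = 0 := fun b => by
    rcases mul_eq_zero.1 (hH b) with h | h <;> simp [h]
  have h1 := D.sum_mul_map_mvPolynomial_aeval x mu y
  simp_rw [hd, add_mul, Finset.sum_add_distrib] at h1
  rw [← D.sum_mul_map_mvPolynomial_aeval, ← D.sum_mul_map_mvPolynomial_aeval] at h1
  simp [hG, hnu, hD, Pi.single_apply] at h1
  exact ho h1

open MvPolynomial in
/-- All values of `y` at points where a combination of the gradients of `y`, with a fixed
coefficient equal to `1`, is a combination of the gradients of the active constraints satisfy one
nonzero polynomial relation. -/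
theorem exists_relation_of_multipliers {k σ α β γ : Type*} [Field k] [CharZero k]
    [Fintype σ] [Fintype α] [Fintype β] [Fintype γ]
    (y : γ → MvPolynomial σ k) (G : α → MvPolynomial σ k) (H : β → MvPolynomial σ k) (o : γ) :
    ∃ Q : MvPolynomial γ k, Q ≠ 0 ∧ ∀ (x : σ → k) (lam : α → k) (nu : β → k) (mu : γ → k),
      mu o = 1 → (∀ a, eval x (G a) = 0) → (∀ b, nu b * eval x (H b) = 0) →
      (∀ i, ∑ c, mu c * eval x (pderiv i (y c)) =
        ∑ a, lam a * eval x (pderiv i (G a)) + ∑ b, nu b * eval x (pderiv i (H b))) →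
      eval (fun c => eval x (y c)) Q = 0 := by
  classical
  let T := σ ⊕ α ⊕ β ⊕ γ
  let V : Set (T → k) := {v | v (.inr (.inr (.inr o))) = 1 ∧
    (∀ a, eval (v ∘ .inl) (G a) = 0) ∧
    (∀ b, v (.inr (.inr (.inl b))) * eval (v ∘ .inl) (H b) = 0) ∧
    ∀ i, ∑ c, v (.inr (.inr (.inr c))) * eval (v ∘ .inl) (pderiv i (y c)) =
      ∑ a, v (.inr (.inl a)) * eval (v ∘ .inl) (pderiv i (G a)) +
        ∑ b, v (.inr (.inr (.inl b))) * eval (v ∘ .inl) (pderiv i (H b))}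
  let I : Ideal (MvPolynomial T k) := vanishingIdeal k V
  have memI : ∀ p, p ∈ I ↔ ∀ v ∈ V, eval v p = 0 := fun p => by
    simp [I, mem_vanishingIdeal_iff, aeval_eq_eval]
  let e : MvPolynomial σ k →ₐ[k] MvPolynomial T k := rename .inl
  have prime_case : ∀ P : Ideal (MvPolynomial T k), P.IsPrime → I ≤ P →
      ∃ Q : MvPolynomial γ k, Q ≠ 0 ∧ aeval (fun c => e (y c)) Q ∈ P := by
    intro P hP hIP
    let K := FractionRing (MvPolynomial T k ⧸ P)
    let φ : MvPolynomial T k →ₐ[k] K :=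
      (IsScalarTower.toAlgHom k (MvPolynomial T k ⧸ P) K).comp (Ideal.Quotient.mkₐ k P)
    have hφ : ∀ p, φ p = 0 ↔ p ∈ P := fun p => by
      simp [φ, K, Ideal.Quotient.eq_zero_iff_mem]
    have hφI : ∀ p ∈ I, φ p = 0 := fun p hp => (hφ p).2 (hIP hp)
    have hφe : ∀ p, φ (e p) = aeval (fun i => φ (X (.inl i))) p := fun p => by
      rw [← AlgHom.comp_apply]
      congr 1
      ext i
      simp [e]
    have hdep := not_algebraicIndependent_of_multipliers (K := K) y G H (fun i => φ (X (.inl i)))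
      (fun a => φ (X (.inr (.inl a)))) (fun b => φ (X (.inr (.inr (.inl b)))))
      (fun c => φ (X (.inr (.inr (.inr c)))))
      (by
        refine Function.ne_iff.2 ⟨o, ?_⟩
        have := hφI (X (.inr (.inr (.inr o))) - 1) ((memI _).2 fun v hv => by simp [hv.1])
        rw [map_sub, map_one, sub_eq_zero] at this
        simp [this])
      (fun a => by
        rw [← hφe]
        exact hφI _ ((memI _).2 fun v hv => by simpa [e, eval_rename] using hv.2.1 a))
      (fun b => by
        rw [← hφe, ← map_mul]
        exact hφI _ ((memI _).2 fun v hv => by simpa [e, eval_rename] using hv.2.2.1 b))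
      (fun i => by
        simp_rw [← hφe, ← map_mul, ← map_sum]
        rw [← map_add, ← sub_eq_zero, ← map_sub]
        refine hφI _ ((memI _).2 fun v hv => ?_)
        simpa [e, eval_rename, sub_eq_zero] using hv.2.2.2 i)
    rw [algebraicIndependent_iff] at hdep
    push Not at hdep
    obtain ⟨Q, hQ, hQ0⟩ := hdep
    refine ⟨Q, hQ0, (hφ _).1 ?_⟩
    rw [← hQ, comp_aeval_apply]
    simp_rw [hφe]
  choose! q hq0 hq using prime_case
  have hfin : I.minimalPrimes.Finite := I.finite_minimalPrimes_of_isNoetherianRing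
  refine ⟨∏ P ∈ hfin.toFinset, q P, Finset.prod_ne_zero_iff.2 fun P hP => ?_, ?_⟩
  · obtain ⟨⟨h1, h2⟩, -⟩ := hfin.mem_toFinset.1 hP
    exact hq0 P h1 h2
  intro x lam nu mu h1 hG hH hd
  have hrad : aeval (fun c => e (y c)) (∏ P ∈ hfin.toFinset, q P) ∈ I.radical := by
    rw [← Ideal.sInf_minimalPrimes, Submodule.mem_sInf]
    intro P hP
    rw [map_prod]
    exact Ideal.mem_of_dvd P (Finset.dvd_prod_of_mem _ (hfin.mem_toFinset.2 hP))
      (hq P hP.1.1 hP.1.2)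
  obtain ⟨N, hN⟩ := hrad
  have h0 := (memI _).1 hN (Sum.elim x (Sum.elim lam (Sum.elim nu mu))) ⟨h1, hG, hH, hd⟩
  rw [map_pow] at h0
  have h2 := eq_zero_of_pow_eq_zero h0
  rw [← coe_aeval_eq_eval, RingHom.coe_coe, comp_aeval_apply] at h2
  have hx : (Sum.elim x (Sum.elim lam (Sum.elim nu mu)) : T → k) ∘ Sum.inl = x := rfl
  simpa [e, aeval_eq_eval, eval_rename, hx] using h2

theorem MvPolynomial.finite_roots_fin_one {k : Type*} [Field k] {Q : MvPolynomial (Fin 1) k}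
    (hQ : Q ≠ 0) : {t : k | MvPolynomial.eval (fun _ => t) Q = 0}.Finite := by
  have hinj : Function.Injective (MvPolynomial.eval (Fin.elim0 : Fin 0 → k)) := by
    intro p q h
    rw [p.eq_C_of_isEmpty, q.eq_C_of_isEmpty, MvPolynomial.eval_C, MvPolynomial.eval_C] at h
    rw [p.eq_C_of_isEmpty, q.eq_C_of_isEmpty, h]
  have hp : Polynomial.map (MvPolynomial.eval (Fin.elim0 : Fin 0 → k))
      (MvPolynomial.finSuccEquiv k 0 Q) ≠ 0 := by
    rw [Polynomial.map_ne_zero_iff hinj]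
    simpa using hQ
  refine (Polynomial.finite_setOfPred_isRoot hp).subset fun t ht => ?_
  rw [Set.mem_ofPred_eq, Polynomial.IsRoot, ← MvPolynomial.eval_eq_eval_mv_eval',
    show (Fin.cons t Fin.elim0 : Fin 1 → k) = fun _ => t by
      ext i
      fin_cases i
      rfl]
  exact ht

theorem MvPolynomial.finite_limits_of_relation {Q : MvPolynomial (Fin 2) ℝ} (hQ : Q ≠ 0) :
    {t : ℝ | ∃ r s : ℕ → ℝ, Tendsto r atTop atTop ∧ Tendsto s atTop (nhds t) ∧
      ∀ᶠ k in atTop, MvPolynomial.eval ![r k, s k] Q = 0}.Finite := by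
  set p := MvPolynomial.finSuccEquiv ℝ 1 Q with hp
  have hp0 : p ≠ 0 := by simpa [hp] using hQ
  refine (MvPolynomial.finite_roots_fin_one (Polynomial.leadingCoeff_ne_zero.2 hp0)).subset ?_
  rintro t ⟨r, s, hr, hs, h⟩
  have hlim : ∀ j ∈ Finset.range (p.natDegree + 1), Tendsto
      (fun k => MvPolynomial.eval (fun _ => s k) (p.coeff j) * (r k ^ j / r k ^ p.natDegree)) atTop
      (nhds (if j = p.natDegree then MvPolynomial.eval (fun _ => t) p.leadingCoeff else 0)) := by
    intro j hj
    have hc : Tendsto (fun k => MvPolynomial.eval (fun _ => s k) (p.coeff j)) atTop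
        (nhds (MvPolynomial.eval (fun _ => t) (p.coeff j))) :=
      ((p.coeff j).continuous_eval.tendsto _).comp (tendsto_pi_nhds.2 fun _ => hs)
    split_ifs with hjd
    · subst hjd
      refine hc.congr' ?_
      filter_upwards [hr.eventually_gt_atTop 0] with k hk
      rw [div_self (by positivity), mul_one]
    · have hlt : j < p.natDegree := by
        have := Finset.mem_range.1 hj
        omega
      simpa using hc.mul ((tendsto_pow_div_pow_atTop_zero hlt).comp hr)
  have hsum := tendsto_finsetSum _ hlim
  rw [Finset.sum_ite_eq', if_pos (by simp)] at hsum
  refine tendsto_nhds_unique hsum (tendsto_const_nhds.congr' ?_)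
  filter_upwards [h] with k hk
  have h2 := MvPolynomial.eval_eq_eval_mv_eval' (fun _ : Fin 1 => s k) (r k) Q
  rw [show (Fin.cons (r k) (fun _ : Fin 1 => s k) : Fin 2 → ℝ) = ![r k, s k] by
    ext i; fin_cases i <;> rfl, hk, ← hp,
    Polynomial.eval_eq_sum_range' (n := p.natDegree + 1)
      (Nat.lt_succ_of_le Polynomial.natDegree_map_le)] at h2
  simp_rw [Polynomial.coeff_map] at h2
  simp_rw [← mul_div_assoc, ← Finset.sum_div]
  rw [← h2, zero_div]

theorem MvPolynomial.hasStrictFDerivAt_eval_euclidean {n : ℕ} (P : MvPolynomial (Fin n) ℝ)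
    (x : EuclideanSpace ℝ (Fin n)) :
    HasStrictFDerivAt (fun z : EuclideanSpace ℝ (Fin n) => MvPolynomial.eval (fun i => z i) P)
      (∑ i, MvPolynomial.eval (fun i => x i) (MvPolynomial.pderiv i P) •
        (EuclideanSpace.proj i : EuclideanSpace ℝ (Fin n) →L[ℝ] ℝ)) x := by
  induction P using MvPolynomial.induction_on with
  | C a => simpa using hasStrictFDerivAt_const a x
  | add p q hp hq =>
    simp only [map_add, add_smul, Finset.sum_add_distrib]
    exact hp.add hq
  | mul_X p j hp =>
    have h := hp.mul (EuclideanSpace.proj j : EuclideanSpace ℝ (Fin n) →L[ℝ] ℝ).hasStrictFDerivAt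
    simp only [map_mul, MvPolynomial.eval_X]
    convert! h using 1
    ext v
    simp [MvPolynomial.pderiv_X, Pi.single_apply, apply_ite, add_mul, Finset.sum_add_distrib,
      Finset.mul_sum, mul_assoc]

theorem IsPolyFun.hasStrictFDerivAt {n : ℕ} {f : EuclideanSpace ℝ (Fin n) → ℝ} (hf : IsPolyFun f)
    (x : EuclideanSpace ℝ (Fin n)) : HasStrictFDerivAt f (fderiv ℝ f x) x := by
  obtain ⟨P, hP⟩ := hf
  have h := P.hasStrictFDerivAt_eval_euclidean x
  rw [← funext hP] at h
  rwa [h.hasFDerivAt.fderiv]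

theorem IsPolyFun.continuous {n : ℕ} {f : EuclideanSpace ℝ (Fin n) → ℝ} (hf : IsPolyFun f) :
    Continuous f :=
  continuous_iff_continuousAt.2 fun x => (hf.hasStrictFDerivAt x).continuousAt

theorem gradient_apply_of_eval {n : ℕ} {f : EuclideanSpace ℝ (Fin n) → ℝ}
    {P : MvPolynomial (Fin n) ℝ} (hP : ∀ x, f x = MvPolynomial.eval (fun i => x i) P)
    (x : EuclideanSpace ℝ (Fin n)) (i : Fin n) :
    gradient f x i = MvPolynomial.eval (fun i => x i) (MvPolynomial.pderiv i P) := by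
  have h := (P.hasStrictFDerivAt_eval_euclidean x).hasFDerivAt.fderiv
  rw [← funext hP] at h
  have h1 : gradient f x i = fderiv ℝ f x (EuclideanSpace.single i 1) := by
    rw [← InnerProductSpace.toDual_symm_apply (𝕜 := ℝ), EuclideanSpace.inner_single_right]
    simp [gradient]
  rw [h1, h]
  simp

theorem IsPolyFun.norm_sq (n : ℕ) : IsPolyFun (fun x : EuclideanSpace ℝ (Fin n) => ‖x‖ ^ 2) :=
  ⟨∑ i, MvPolynomial.X i ^ 2, fun x => by simp [EuclideanSpace.norm_sq_eq]⟩

theorem gradient_norm_sq {n : ℕ} (x : EuclideanSpace ℝ (Fin n)) :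
    gradient (fun z : EuclideanSpace ℝ (Fin n) => ‖z‖ ^ 2) x = (2 : ℝ) • x := by
  ext i
  rw [gradient_apply_of_eval (P := ∑ i, MvPolynomial.X i ^ 2)
    (fun x => by simp [EuclideanSpace.norm_sq_eq])]
  simp [MvPolynomial.pderiv_X, Pi.single_apply]

/-- Lagrange multipliers for equality constraints, in terms of gradients. -/
theorem exists_multipliers_of_isLocalMinOn {n : ℕ} {ι : Type*} [Fintype ι]
    {φ : EuclideanSpace ℝ (Fin n) → ℝ} {q : ι → EuclideanSpace ℝ (Fin n) → ℝ}
    (hφ : IsPolyFun φ) (hq : ∀ i, IsPolyFun (q i)) {x : EuclideanSpace ℝ (Fin n)}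
    (hx : IsLocalMinOn φ {z | ∀ i, q i z = q i x} x) :
    ∃ (Λ : ι → ℝ) (Λ₀ : ℝ), (Λ, Λ₀) ≠ 0 ∧
      ∑ i, Λ i • gradient (q i) x + Λ₀ • gradient φ x = 0 := by
  obtain ⟨Λ, Λ₀, h0, h⟩ := IsLocalExtrOn.exists_multipliers_of_hasStrictFDerivAt (Or.inl hx)
    (fun i => (hq i).hasStrictFDerivAt x) (hφ.hasStrictFDerivAt x)
  refine ⟨Λ, Λ₀, h0, ?_⟩
  have h1 := congrArg (InnerProductSpace.toDual ℝ (EuclideanSpace ℝ (Fin n))).symm h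
  simpa [gradient] using h1

theorem sum_subtype_smul_eq_sum {ι E : Type*} [Fintype ι] [AddCommGroup E] [Module ℝ E]
    {p : ι → Prop} [DecidablePred p] {c : ι → ℝ} (hc : ∀ j, ¬ p j → c j = 0) (v : ι → E) :
    ∑ j : {j // p j}, c j • v j = ∑ j, c j • v j := by
  rw [← Finset.sum_subtype (Finset.univ.filter p) (by simp) fun j => c j • v j]
  exact Finset.sum_filter_of_ne fun j _ hj => by
    by_contra hp
    exact hj (by rw [hc j hp, zero_smul])

section Constrained

variable {n l m : ℕ} {f : EuclideanSpace ℝ (Fin n) → ℝ}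
  {g : Fin l → EuclideanSpace ℝ (Fin n) → ℝ} {h : Fin m → EuclideanSpace ℝ (Fin n) → ℝ}

theorem isClosed_conSet (hg : ∀ i, IsPolyFun (g i)) (hh : ∀ j, IsPolyFun (h j)) :
    IsClosed (conSet g h) := by
  have : conSet g h = (⋂ i, {x | g i x = 0}) ∩ ⋂ j, {x | 0 ≤ h j x} := by
    ext x
    simp [conSet]
  rw [this]
  exact (isClosed_iInter fun i => isClosed_eq (hg i).continuous continuous_const).inter
    (isClosed_iInter fun j => isClosed_le continuous_const (hh j).continuous)

theorem LICQ.eq_zero (hlicq : LICQ g h) {x : EuclideanSpace ℝ (Fin n)} (hx : x ∈ conSet g h)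
    {lam : Fin l → ℝ} {nu : Fin m → ℝ}
    (hsum : ∑ i, lam i • gradient (g i) x + ∑ j, nu j • gradient (h j) x = 0)
    (hnu : ∀ j, nu j * h j x = 0) : lam = 0 ∧ nu = 0 := by
  classical
  have hz : ∀ j, h j x ≠ 0 → nu j = 0 := fun j hj => (mul_eq_zero.1 (hnu j)).resolve_right hj
  have hsub : ∑ j : {j // h j x = 0}, nu j • gradient (h j) x = ∑ j, nu j • gradient (h j) x :=
    sum_subtype_smul_eq_sum hz fun j => gradient (h j) x
  have hli := Fintype.linearIndependent_iff.1 (hlicq x hx) (Sum.elim lam fun j => nu j)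
    (by simpa [hsub] using hsum)
  refine ⟨funext fun i => hli (.inl i), funext fun j => ?_⟩
  by_cases hj : h j x = 0
  · exact hli (.inr ⟨j, hj⟩)
  · exact hz j hj

/-- Fritz John conditions for a minimizer of `f` on `conSet g h` subject to further equality
constraints. -/
theorem exists_fritzJohn_multipliers {ι : Type*} [Fintype ι] {e : ι → EuclideanSpace ℝ (Fin n) → ℝ}
    (hf : IsPolyFun f) (hg : ∀ i, IsPolyFun (g i)) (hh : ∀ j, IsPolyFun (h j))
    (he : ∀ c, IsPolyFun (e c)) {x : EuclideanSpace ℝ (Fin n)} (hx : x ∈ conSet g h)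
    (hmin : ∀ z ∈ conSet g h, (∀ c, e c z = e c x) → f x ≤ f z) :
    ∃ (κ : ℝ) (lam : Fin l → ℝ) (nu : Fin m → ℝ) (mu : ι → ℝ), (κ, lam, nu, mu) ≠ 0 ∧
      κ • gradient f x - ∑ i, lam i • gradient (g i) x - ∑ j, nu j • gradient (h j) x
        - ∑ c, mu c • gradient (e c) x = 0 ∧ ∀ j, nu j * h j x = 0 := by
  classical
  let q : Fin l ⊕ {j // h j x = 0} ⊕ ι → EuclideanSpace ℝ (Fin n) → ℝ :=
    Sum.elim g (Sum.elim (fun j => h j) e)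
  have hq : ∀ i, IsPolyFun (q i) := by
    rintro (i | j | c)
    exacts [hg i, hh j, he c]
  have hloc : IsLocalMinOn f {z | ∀ i, q i z = q i x} x := by
    have hpos : ∀ᶠ z in nhds x, ∀ j, h j x ≠ 0 → 0 < h j z := by
      refine eventually_all.2 fun j => ?_
      by_cases hj : h j x = 0
      · simp [hj]
      · filter_upwards [(hh j).continuous.continuousAt.eventually_const_lt
          (lt_of_le_of_ne (hx.2 j) (Ne.symm hj))] with z hz _ using hz
    filter_upwards [nhdsWithin_le_nhds hpos, self_mem_nhdsWithin] with z hz hzq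
    refine hmin z ⟨fun i => (hzq (.inl i)).trans (hx.1 i), fun j => ?_⟩
      fun c => hzq (.inr (.inr c))
    by_cases hj : h j x = 0
    · exact ((hzq (.inr (.inl ⟨j, hj⟩))).trans hj).ge
    · exact (hz j hj).le
  obtain ⟨Λ, κ, h0, hsum⟩ := exists_multipliers_of_isLocalMinOn hf hq hloc
  let nu : Fin m → ℝ := fun j => if hj : h j x = 0 then -Λ (.inr (.inl ⟨j, hj⟩)) else 0
  have hnu : ∀ j : {j // h j x = 0}, nu j = -Λ (.inr (.inl j)) := fun j => dif_pos j.2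
  have hz : ∀ j, h j x ≠ 0 → nu j = 0 := fun j hj => dif_neg hj
  have hsub : ∑ j : {j // h j x = 0}, nu j • gradient (h j) x = ∑ j, nu j • gradient (h j) x :=
    sum_subtype_smul_eq_sum hz fun j => gradient (h j) x
  refine ⟨κ, fun i => -Λ (.inl i), nu, fun c => -Λ (.inr (.inr c)), fun hzero => h0 ?_, ?_,
    fun j => ?_⟩
  · simp only [Prod.mk_eq_zero, funext_iff, Pi.zero_apply, neg_eq_zero] at hzero ⊢
    refine ⟨?_, hzero.1⟩
    rintro (i | j | c)
    · exact hzero.2.1 i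
    · rw [← neg_eq_zero, ← hnu, hzero.2.2.1]
    · exact hzero.2.2.2 c
  · rw [← hsub, ← hsum]
    simp only [hnu, q, Fintype.sum_sum_type, Sum.elim_inl, Sum.elim_inr, neg_smul,
      Finset.sum_neg_distrib]
    abel
  · by_cases hj : h j x = 0
    · rw [hj, mul_zero]
    · rw [hz j hj, zero_mul]

theorem mem_criticalSet_of_isMinOn (hf : IsPolyFun f) (hg : ∀ i, IsPolyFun (g i))
    (hh : ∀ j, IsPolyFun (h j)) (hlicq : LICQ g h) {x : EuclideanSpace ℝ (Fin n)}
    (hx : x ∈ conSet g h) (hmin : ∀ z ∈ conSet g h, f x ≤ f z) : x ∈ criticalSet f g h := by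
  obtain ⟨κ, lam, nu, mu, h0, hsum, hnu⟩ := exists_fritzJohn_multipliers (ι := Fin 0) (e := ![])
    hf hg hh (fun c => c.elim0) hx fun z hz _ => hmin z hz
  rw [Fin.sum_univ_zero, sub_zero] at hsum
  have hκ : κ ≠ 0 := by
    rintro rfl
    obtain ⟨rfl, rfl⟩ := hlicq.eq_zero hx (lam := lam) (nu := nu)
      (by rw [← neg_eq_zero, ← hsum, zero_smul]; abel) hnu
    exact h0 (by simp [Subsingleton.elim mu 0])
  refine ⟨hx, κ⁻¹ • lam, κ⁻¹ • nu, ?_, fun j => by simp [mul_assoc, hnu]⟩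
  have := congrArg (κ⁻¹ • ·) hsum
  simpa [smul_sub, smul_smul, hκ, Finset.smul_sum] using this

theorem mem_tangencySet_of_isMinOn_sphere (hf : IsPolyFun f) (hg : ∀ i, IsPolyFun (g i))
    (hh : ∀ j, IsPolyFun (h j)) {x : EuclideanSpace ℝ (Fin n)} (hx : x ∈ conSet g h)
    (hmin : ∀ z ∈ conSet g h, ‖z‖ = ‖x‖ → f x ≤ f z) : x ∈ tangencySet f g h := by
  obtain ⟨κ, lam, nu, mu, h0, hsum, hnu⟩ := exists_fritzJohn_multipliers (ι := Fin 1)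
    (e := fun _ z => ‖z‖ ^ 2) hf hg hh (fun _ => .norm_sq n) hx fun z hz hzx =>
      hmin z hz (by simpa using hzx 0)
  refine ⟨hx, κ, lam, nu, 2 * mu 0, fun hzero => h0 ?_, ?_, hnu⟩
  · simp only [Prod.mk_eq_zero, mul_eq_zero, OfNat.ofNat_ne_zero, false_or] at hzero ⊢
    exact ⟨hzero.1, hzero.2.1, hzero.2.2.1, funext fun c => by
      rw [Subsingleton.elim c 0, hzero.2.2.2, Pi.zero_apply]⟩
  · simpa [gradient_norm_sq, smul_smul, mul_comm] using hsum

theorem finite_image_criticalSet (hf : IsPolyFun f) (hg : ∀ i, IsPolyFun (g i))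
    (hh : ∀ j, IsPolyFun (h j)) : (f '' criticalSet f g h).Finite := by
  obtain ⟨F, hF⟩ := hf
  choose G hG using hg
  choose H hH using hh
  obtain ⟨Q, hQ, hrel⟩ := exists_relation_of_multipliers ![F] G H 0
  refine (MvPolynomial.finite_roots_fin_one hQ).subset ?_
  rintro _ ⟨x, ⟨hx, lam, nu, hsum, hnu⟩, rfl⟩
  have := hrel (fun i => x i) lam nu ![1] rfl (fun a => by rw [← hG, hx.1])
    (fun b => by rw [← hH, hnu]) fun i => by
      have := congrArg (fun v : EuclideanSpace ℝ (Fin n) => v i) hsum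
      simp [gradient_apply_of_eval hF, gradient_apply_of_eval (hG _),
        gradient_apply_of_eval (hH _)] at this
      simp
      linarith
  simpa [hF] using this

theorem finite_tangencyValues (hf : IsPolyFun f) (hg : ∀ i, IsPolyFun (g i))
    (hh : ∀ j, IsPolyFun (h j)) (hlicq : LICQ g h) : (tangencyValues f g h).Finite := by
  obtain ⟨F, hF⟩ := hf
  choose G hG using hg
  choose H hH using hh
  obtain ⟨R, hR⟩ := IsPolyFun.norm_sq n
  obtain ⟨Q₁, hQ₁, hrel₁⟩ := exists_relation_of_multipliers ![R] G H 0
  obtain ⟨Q₂, hQ₂, hrel₂⟩ := exists_relation_of_multipliers ![R, F] G H 1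
  have hgR : ∀ (x : EuclideanSpace ℝ (Fin n)) i,
      MvPolynomial.eval (fun i => x i) (MvPolynomial.pderiv i R) = 2 * x i := fun x i => by
    rw [← gradient_apply_of_eval hR, gradient_norm_sq]
    simp
  obtain ⟨B, hB⟩ := (MvPolynomial.finite_roots_fin_one hQ₁).bddAbove
  have hrel : ∀ x ∈ tangencySet f g h, B < ‖x‖ ^ 2 →
      MvPolynomial.eval ![‖x‖ ^ 2, f x] Q₂ = 0 := by
    rintro x ⟨hx, κ, lam, nu, mu, h0, hsum, hnu⟩ hBx
    have hcoord := fun i => congrArg (fun v : EuclideanSpace ℝ (Fin n) => v i) hsum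
    simp [gradient_apply_of_eval hF, gradient_apply_of_eval (hG _),
        gradient_apply_of_eval (hH _)] at hcoord
    have hκ : κ ≠ 0 := by
      rintro rfl
      have hmu : mu ≠ 0 := by
        rintro rfl
        obtain ⟨rfl, rfl⟩ := hlicq.eq_zero hx (lam := lam) (nu := nu)
          (by rw [← neg_eq_zero, ← hsum, zero_smul, zero_smul]; abel) hnu
        exact h0 rfl
      refine hBx.not_ge (hB ?_)
      have := hrel₁ (fun i => x i) (fun a => -(2 / mu) * lam a) (fun b => -(2 / mu) * nu b) ![1] rfl
        (fun a => by rw [← hG, hx.1]) (fun b => by rw [← hH, mul_assoc, hnu, mul_zero])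
        fun i => by
          simp [hgR, mul_assoc, ← Finset.mul_sum]
          have := hcoord i
          field_simp
          linarith
      simpa [← hR] using this
    have := hrel₂ (fun i => x i) (fun a => κ⁻¹ * lam a) (fun b => κ⁻¹ * nu b)
      ![-(mu / κ / 2), 1] rfl
      (fun a => by rw [← hG, hx.1]) (fun b => by rw [← hH, mul_assoc, hnu, mul_zero])
      fun i => by
        simp [hgR, mul_assoc, ← Finset.mul_sum]
        have := hcoord i
        field_simp
        linarith
    have hv : ![‖x‖ ^ 2, f x] = fun c => MvPolynomial.eval (fun i => x i) (![R, F] c) := by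
      ext c
      fin_cases c <;> simp [← hR, hF]
    rwa [hv]
  refine (MvPolynomial.finite_limits_of_relation hQ₂).subset ?_
  rintro t ⟨x, hx, hnorm, hlim⟩
  have hsq : Tendsto (fun k => ‖x k‖ ^ 2) atTop atTop :=
    (tendsto_pow_atTop two_ne_zero).comp hnorm
  refine ⟨fun k => ‖x k‖ ^ 2, fun k => f (x k), hsq, hlim, ?_⟩
  filter_upwards [hsq.eventually_gt_atTop B] with k hk using hrel _ (hx k) hk

theorem sInf_mem_tangencyValues_of_not_attained (hf : IsPolyFun f) (hg : ∀ i, IsPolyFun (g i))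
    (hh : ∀ j, IsPolyFun (h j)) (hS : (conSet g h).Nonempty) (hbdd : BddBelow (f '' conSet g h))
    (hna : ∀ x ∈ conSet g h, f x ≠ sInf (f '' conSet g h)) :
    sInf (f '' conSet g h) ∈ tangencyValues f g h := by
  have hcl := isClosed_conSet hg hh
  obtain ⟨u, -, hu, huS⟩ := exists_seq_tendsto_sInf (hS.image f) hbdd
  choose y hyS hyu using huS
  have hex : ∀ k, ∃ x ∈ conSet g h, ‖x‖ = ‖y k‖ ∧ ∀ z ∈ conSet g h, ‖z‖ = ‖x‖ → f x ≤ f z := by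
    intro k
    obtain ⟨x, ⟨hxS, hxn⟩, hmin⟩ := ((isCompact_sphere 0 ‖y k‖).inter_left hcl).exists_isMinOn
      ⟨y k, hyS k, by simp⟩ hf.continuous.continuousOn
    have hxn : ‖x‖ = ‖y k‖ := by simpa using hxn
    exact ⟨x, hxS, hxn, fun z hz hzx => hmin ⟨hz, by simpa using hzx.trans hxn⟩⟩
  choose x hxS hxn hmin using hex
  refine ⟨x, fun k => mem_tangencySet_of_isMinOn_sphere hf hg hh (hxS k) (hmin k), ?_, ?_⟩
  · simp_rw [hxn]
    refine tendsto_atTop.2 fun r => ?_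
    rcases (conSet g h ∩ Metric.closedBall 0 r).eq_empty_or_nonempty with hemp | hne
    · refine Eventually.of_forall fun k => ?_
      by_contra! hk
      exact hemp.subset ⟨hyS k, by simpa using hk.le⟩
    · obtain ⟨z, ⟨hzS, -⟩, hz⟩ := ((isCompact_closedBall 0 r).inter_left hcl).exists_isMinOn hne
        hf.continuous.continuousOn
      have hlt : sInf (f '' conSet g h) < f z :=
        lt_of_le_of_ne (csInf_le hbdd ⟨z, hzS, rfl⟩) (hna z hzS).symm
      filter_upwards [hu.eventually_lt_const hlt] with k hk
      by_contra! hkr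
      have : f z ≤ f (y k) := hz ⟨hyS k, by simpa using hkr.le⟩
      rw [hyu] at this
      exact this.not_gt hk
  · refine tendsto_of_tendsto_of_tendsto_of_le_of_le tendsto_const_nhds hu
      (fun k => csInf_le hbdd ⟨x k, hxS k, rfl⟩) fun k => ?_
    rw [← hyu]
    exact hmin k (y k) (hyS k) (hxn k).symm

theorem sInf_le_of_mem_tangencyValues (hbdd : BddBelow (f '' conSet g h)) {t : ℝ}
    (ht : t ∈ tangencyValues f g h) : sInf (f '' conSet g h) ≤ t := by
  obtain ⟨x, hx, -, hlim⟩ := ht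
  exact ge_of_tendsto' hlim fun k => csInf_le hbdd ⟨x k, (hx k).1, rfl⟩

end Constrained

theorem inf_eq_min_of_critical_and_tangency_values {n l m : ℕ} (f : EuclideanSpace ℝ (Fin n) → ℝ)
    (g : Fin l → EuclideanSpace ℝ (Fin n) → ℝ) (h : Fin m → EuclideanSpace ℝ (Fin n) → ℝ)
    (hf : IsPolyFun f) (hg : ∀ i, IsPolyFun (g i)) (hh : ∀ j, IsPolyFun (h j))
    (hS : (conSet g h).Nonempty) (hSu : ¬ Bornology.IsBounded (conSet g h))
    (hlicq : LICQ g h) (hbdd : BddBelow (f '' conSet g h)) :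
    (f '' criticalSet f g h ∪ tangencyValues f g h).Nonempty ∧
    (f '' criticalSet f g h ∪ tangencyValues f g h).Finite ∧
    IsLeast (f '' criticalSet f g h ∪ tangencyValues f g h) (sInf (f '' conSet g h)) := by
  have hmem : sInf (f '' conSet g h) ∈ f '' criticalSet f g h ∪ tangencyValues f g h := by
    by_cases hna : ∀ x ∈ conSet g h, f x ≠ sInf (f '' conSet g h)
    · exact Or.inr (sInf_mem_tangencyValues_of_not_attained hf hg hh hS hbdd hna)
    · push Not at hna
      obtain ⟨x, hx, hfx⟩ := hna
      exact Or.inl ⟨x, mem_criticalSet_of_isMinOn hf hg hh hlicq hx fun z hz =>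
        hfx ▸ csInf_le hbdd ⟨z, hz, rfl⟩, hfx⟩
  refine ⟨⟨_, hmem⟩, (finite_image_criticalSet hf hg hh).union
    (finite_tangencyValues hf hg hh hlicq), hmem, ?_⟩
  rintro _ (⟨x, hx, rfl⟩ | ht)
  · exact csInf_le hbdd ⟨x, hx.1, rfl⟩
  · exact sInf_le_of_mem_tangencyValues hbdd ht
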